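/- Let A be a bialgebra, V, W k-vector spaces, M = V⊗A and N = W⊗A free left-right Hopf modules. Then H^{p+1}(V⊗A, W⊗A) = 0 for all p ≥ 0, where H^* denotes the cohomology of the total complex of the Hopf-module bicomplex C^{n,p}(M,N). Equivalently, Ker(d_m^{0,p+1}) ∩ Ker(d_c^{0,p+1}) = d_c^{0,p}(Ker(d_m^{0,p})). -/

import Mathlib

open TensorProduct
noncomputable section

namespace PS

variable (k : Type) [Field k] (A : Type) [Ring A] [Bialgebra k A]

/-- Left-nested tensor powers with base `B`: `pwr B n = B ⊗ A ⊗ ⋯ ⊗ A` (`n` copies of `A`). -/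
def pwr (B : ModuleCat k) : ℕ → ModuleCat k
  | 0 => B
  | n + 1 => ModuleCat.of k (pwr B n ⊗[k] A)

/-- `A^{⊗ n}` realized as `pwr k n`, i.e. `k ⊗ A ⊗ ⋯ ⊗ A`. -/
abbrev Pk (n : ℕ) : ModuleCat k := pwr k A (ModuleCat.of k k) n

abbrev μA : A ⊗[k] A →ₗ[k] A := LinearMap.mul' k A
abbrev ΔA : A →ₗ[k] A ⊗[k] A := Coalgebra.comul
abbrev εA : A →ₗ[k] k := Coalgebra.counit

/-- Multiplication of the tensorands in slots `i` and `i+1` (`1 ≤ i ≤ n`);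
junk (zero map) for other `i`. -/
def mulP : (n : ℕ) → (i : ℕ) → ((Pk k A (n+1) : Type) →ₗ[k] Pk k A n)
  | 0, _ => 0
  | n + 1, i =>
      if i = n + 1 then
        (TensorProduct.map (LinearMap.id : (Pk k A n : Type) →ₗ[k] Pk k A n) (μA k A)).comp
          (TensorProduct.assoc k (Pk k A n) A A).toLinearMap
      else
        TensorProduct.map (mulP n i) (LinearMap.id : A →ₗ[k] A)

/-- Insert an `A`-factor at the innermost slot (slot 1). -/
def insP : (n : ℕ) → (A ⊗[k] (Pk k A n : Type)) ≃ₗ[k] (Pk k A (n+1) : Type)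
  | 0 => TensorProduct.comm k A k
  | n + 1 =>
      (TensorProduct.assoc k A (Pk k A n) A).symm.trans
        (TensorProduct.congr (insP n) (LinearEquiv.refl k A))

section NM

variable {N : Type} [AddCommGroup N] [Module k N]

/-- The left diagonal action of `A` on `N ⊗ A^{⊗ p}` built from a base action `ωN`. -/
def ldiag (ωN : A ⊗[k] N →ₗ[k] N) :
    (p : ℕ) → (A ⊗[k] (pwr k A (ModuleCat.of k N) p : Type) →ₗ[k] pwr k A (ModuleCat.of k N) p)
  | 0 => ωN
  | p + 1 =>
      (TensorProduct.map (ldiag ωN p) (μA k A)).comp <|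
        ((TensorProduct.tensorTensorTensorComm k A A
            (pwr k A (ModuleCat.of k N) p : Type) A).toLinearMap).comp
          (TensorProduct.map (ΔA k A) (LinearMap.id :
            ((pwr k A (ModuleCat.of k N) p : Type) ⊗[k] A) →ₗ[k] _))

/-- Right diagonal multiplication on the `A`-slots of `N ⊗ A^{⊗ p}` (counit on the base). -/
def rdiagE : (p : ℕ) →
    ((pwr k A (ModuleCat.of k N) p : Type) ⊗[k] A →ₗ[k] pwr k A (ModuleCat.of k N) p)
  | 0 => (TensorProduct.rid k N).toLinearMap.comp
      (TensorProduct.map (LinearMap.id : N →ₗ[k] N) (εA k A))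
  | p + 1 =>
      (TensorProduct.map (rdiagE p) (μA k A)).comp <|
        ((TensorProduct.tensorTensorTensorComm k
            (pwr k A (ModuleCat.of k N) p : Type) A A A).toLinearMap).comp
          (TensorProduct.map
            (LinearMap.id : ((pwr k A (ModuleCat.of k N) p : Type) ⊗[k] A) →ₗ[k] _) (ΔA k A))

/-- Right diagonal action on `N ⊗ A^{⊗ p}` built from a base (right) action `ωNr`. -/
def rdiagAct (ωNr : N ⊗[k] A →ₗ[k] N) : (p : ℕ) →
    ((pwr k A (ModuleCat.of k N) p : Type) ⊗[k] A →ₗ[k] pwr k A (ModuleCat.of k N) p)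
  | 0 => ωNr
  | p + 1 =>
      (TensorProduct.map (rdiagAct ωNr p) (μA k A)).comp <|
        ((TensorProduct.tensorTensorTensorComm k
            (pwr k A (ModuleCat.of k N) p : Type) A A A).toLinearMap).comp
          (TensorProduct.map
            (LinearMap.id : ((pwr k A (ModuleCat.of k N) p : Type) ⊗[k] A) →ₗ[k] _) (ΔA k A))

end NM

/-- `dL : A^{⊗ n} → A ⊗ A^{⊗ n}`, `a^1 ⊗ ⋯ ⊗ a^n ↦ Σ (a^1)_1 ⋯ (a^n)_1 ⊗ ((a^1)_2 ⊗ ⋯ ⊗ (a^n)_2)`. -/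
def dL : (n : ℕ) → ((Pk k A n : Type) →ₗ[k] A ⊗[k] (Pk k A n : Type))
  | 0 => (TensorProduct.map (Algebra.linearMap k A) (LinearMap.id : k →ₗ[k] k)).comp
      (TensorProduct.lid k k).symm.toLinearMap
  | n + 1 =>
      (TensorProduct.map (μA k A)
          (LinearMap.id : ((Pk k A n : Type) ⊗[k] A) →ₗ[k] _)).comp <|
        ((TensorProduct.tensorTensorTensorComm k A (Pk k A n : Type) A A).toLinearMap).comp
          (TensorProduct.map (dL n) (ΔA k A))

/-- `dR : A^{⊗ n} → A^{⊗ n} ⊗ A`, `a^1 ⊗ ⋯ ⊗ a^n ↦ Σ ((a^1)_1 ⊗ ⋯ ⊗ (a^n)_1) ⊗ (a^1)_2 ⋯ (a^n)_2`. -/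
def dR : (n : ℕ) → ((Pk k A n : Type) →ₗ[k] (Pk k A n : Type) ⊗[k] A)
  | 0 => (TensorProduct.map (LinearMap.id : k →ₗ[k] k) (Algebra.linearMap k A)).comp
      (TensorProduct.rid k k).symm.toLinearMap
  | n + 1 =>
      (TensorProduct.map
          (LinearMap.id : ((Pk k A n : Type) ⊗[k] A) →ₗ[k] _) (μA k A)).comp <|
        ((TensorProduct.tensorTensorTensorComm k (Pk k A n : Type) A A A).toLinearMap).comp
          (TensorProduct.map (dR n) (ΔA k A))

section Base

variable {N : Type} [AddCommGroup N] [Module k N]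

/-- Apply `ρN : N → N ⊗ A` to the base of `N ⊗ A^{⊗ p}`. -/
def rhoBase (ρN : N →ₗ[k] N ⊗[k] A) : (p : ℕ) →
    ((pwr k A (ModuleCat.of k N) p : Type) →ₗ[k] pwr k A (ModuleCat.of k (N ⊗[k] A)) p)
  | 0 => ρN
  | p + 1 => TensorProduct.map (rhoBase ρN p) (LinearMap.id : A →ₗ[k] A)

/-- Reinterpret `(N ⊗ A) ⊗ A^{⊗ p}` as `N ⊗ A^{⊗ (p+1)}`. -/
def shiftB : (p : ℕ) →
    ((pwr k A (ModuleCat.of k (N ⊗[k] A)) p : Type) ≃ₗ[k] pwr k A (ModuleCat.of k N) (p+1))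
  | 0 => LinearEquiv.refl k (N ⊗[k] A)
  | p + 1 => TensorProduct.congr (shiftB p) (LinearEquiv.refl k A)

/-- Multiply the `A`-component of the base `N ⊗ A` on the right by an element of `A`. -/
def rmulBase : (p : ℕ) →
    ((pwr k A (ModuleCat.of k (N ⊗[k] A)) p : Type) ⊗[k] A →ₗ[k]
      pwr k A (ModuleCat.of k (N ⊗[k] A)) p)
  | 0 => (TensorProduct.map (LinearMap.id : N →ₗ[k] N) (μA k A)).comp
      (TensorProduct.assoc k N A A).toLinearMap
  | p + 1 =>
      (TensorProduct.map (rmulBase p) (LinearMap.id : A →ₗ[k] A)).comp <|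
        ((TensorProduct.assoc k (pwr k A (ModuleCat.of k (N ⊗[k] A)) p : Type) A A).symm.toLinearMap).comp <|
          (TensorProduct.map
            (LinearMap.id : (pwr k A (ModuleCat.of k (N ⊗[k] A)) p : Type) →ₗ[k] _)
            (TensorProduct.comm k A A).toLinearMap).comp
            (TensorProduct.assoc k
              (pwr k A (ModuleCat.of k (N ⊗[k] A)) p : Type) A A).toLinearMap

/-- Apply the counit to the `A`-component of the base `N ⊗ A`. -/
def epsBase : (p : ℕ) →
    ((pwr k A (ModuleCat.of k (N ⊗[k] A)) p : Type) →ₗ[k] pwr k A (ModuleCat.of k N) p)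
  | 0 => (TensorProduct.rid k N).toLinearMap.comp
      (TensorProduct.map (LinearMap.id : N →ₗ[k] N) (εA k A))
  | p + 1 => TensorProduct.map (epsBase p) (LinearMap.id : A →ₗ[k] A)

/-- Apply `Δ` on the `i`-th `A`-slot (`1 ≤ i ≤ p`) of `N ⊗ A^{⊗ p}`; junk otherwise. -/
def comulAt : (p : ℕ) → (i : ℕ) →
    ((pwr k A (ModuleCat.of k N) p : Type) →ₗ[k] pwr k A (ModuleCat.of k N) (p+1))
  | 0, _ => 0
  | p + 1, i =>
      if i = p + 1 then
        ((TensorProduct.assoc k (pwr k A (ModuleCat.of k N) p : Type) A A).symm.toLinearMap).comp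
          (TensorProduct.map
            (LinearMap.id : (pwr k A (ModuleCat.of k N) p : Type) →ₗ[k] _) (ΔA k A))
      else
        TensorProduct.map (comulAt p i) (LinearMap.id : A →ₗ[k] A)

/-- Left coaction on `N ⊗ A^{⊗ p}` coming from a left coaction on the base. -/
def lcoBase (ρNl : N →ₗ[k] A ⊗[k] N) : (p : ℕ) →
    ((pwr k A (ModuleCat.of k N) p : Type) →ₗ[k]
      A ⊗[k] (pwr k A (ModuleCat.of k N) p : Type))
  | 0 => ρNl
  | p + 1 =>
      ((TensorProduct.assoc k A (pwr k A (ModuleCat.of k N) p : Type) A).toLinearMap).comp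
        (TensorProduct.map (lcoBase ρNl p) (LinearMap.id : A →ₗ[k] A))

end Base

section Bicomplex

variable {M N : Type} [AddCommGroup M] [Module k M] [AddCommGroup N] [Module k N]

/-- `A^{⊗ n} ⊗ M`, the domain of the `(n,p)` cochains. -/
abbrev Dm (M : Type) [AddCommGroup M] [Module k M] (n : ℕ) : Type :=
  (Pk k A n : Type) ⊗[k] M

/-- `N ⊗ A^{⊗ p}`. -/
abbrev Cd (N : Type) [AddCommGroup N] [Module k N] (p : ℕ) : Type :=
  (pwr k A (ModuleCat.of k N) p : Type)

/-- The space of `(n,p)` cochains `Hom(A^{⊗ n} ⊗ M, N ⊗ A^{⊗ p})`. -/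
abbrev Yc (M N : Type) [AddCommGroup M] [Module k M] [AddCommGroup N] [Module k N]
    (n p : ℕ) : Type := Dm k A M n →ₗ[k] Cd k A N p

variable (ωM : A ⊗[k] M →ₗ[k] M) (ρM : M →ₗ[k] M ⊗[k] A)
variable (ωN : A ⊗[k] N →ₗ[k] N) (ρN : N →ₗ[k] N ⊗[k] A)

/-- `b_0`: the face using the diagonal left action of `a^1` on `N ⊗ A^{⊗ p}`. -/
def face0 (n p : ℕ) (f : Yc k A M N n p) : Yc k A M N (n+1) p :=
  (ldiag k A ωN p).comp <|
    (TensorProduct.map (LinearMap.id : A →ₗ[k] A) f).comp <|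
      ((TensorProduct.assoc k A (Pk k A n : Type) M).toLinearMap).comp
        (TensorProduct.map (insP k A n).symm.toLinearMap (LinearMap.id : M →ₗ[k] M))

/-- `b_i`, `1 ≤ i ≤ n`: multiply the adjacent arguments `a^i a^{i+1}`. -/
def faceMid (n p : ℕ) (i : ℕ) (f : Yc k A M N n p) : Yc k A M N (n+1) p :=
  f.comp (TensorProduct.map (mulP k A n i) (LinearMap.id : M →ₗ[k] M))

/-- `b_{n+1}` in the Hopf-module case: `f(a^1 ⊗ ⋯ ⊗ a^n ⊗ a^{n+1}·m)`. -/
def faceLastH (n p : ℕ) (f : Yc k A M N n p) : Yc k A M N (n+1) p :=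
  f.comp <|
    (TensorProduct.map (LinearMap.id : (Pk k A n : Type) →ₗ[k] _) ωM).comp
      (TensorProduct.assoc k (Pk k A n : Type) A M).toLinearMap

/-- `b_{n+1}` in the Yetter-Drinfel'd case. -/
def faceLastYD (n p : ℕ) (f : Yc k A M N n p) : Yc k A M N (n+1) p :=
  (rdiagE k A p).comp <|
    ((TensorProduct.comm k A (Cd k A N p)).toLinearMap).comp <|
      (TensorProduct.map (LinearMap.id : A →ₗ[k] A)
        (f.comp (TensorProduct.map (LinearMap.id : (Pk k A n : Type) →ₗ[k] _) ωM))).comp <|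
        ((TensorProduct.leftComm k (Pk k A n : Type) A (A ⊗[k] M)).toLinearMap).comp <|
          (TensorProduct.map (LinearMap.id : (Pk k A n : Type) →ₗ[k] _)
            (TensorProduct.assoc k A A M).toLinearMap).comp <|
            ((TensorProduct.assoc k (Pk k A n : Type) (A ⊗[k] A) M).toLinearMap).comp
              (TensorProduct.map
                (TensorProduct.map (LinearMap.id : (Pk k A n : Type) →ₗ[k] _) (ΔA k A))
                (LinearMap.id : M →ₗ[k] M))

/-- The Yetter-Drinfel'd horizontal faces `b_i^{n,p}`, `0 ≤ i ≤ n+1`. -/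
def bYD (n p : ℕ) (i : ℕ) (f : Yc k A M N n p) : Yc k A M N (n+1) p :=
  if i = 0 then face0 k A ωN n p f
  else if i ≤ n then faceMid k A n p i f
  else faceLastYD k A ωM n p f

/-- The Hopf-module horizontal faces `b_i^{n,p}`, `0 ≤ i ≤ n+1`. -/
def bH (n p : ℕ) (i : ℕ) (f : Yc k A M N n p) : Yc k A M N (n+1) p :=
  if i = 0 then face0 k A ωN n p f
  else if i ≤ n then faceMid k A n p i f
  else faceLastH k A ωM n p f

/-- `c_0` in the Hopf-module case: apply `ρ_N` to the `N`-component of the output. -/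
def cof0H (n p : ℕ) (f : Yc k A M N n p) : Yc k A M N n (p+1) :=
  ((shiftB k A p).toLinearMap).comp ((rhoBase k A ρN p).comp f)

/-- `c_0` in the Yetter-Drinfel'd case. -/
def cof0YD (n p : ℕ) (f : Yc k A M N n p) : Yc k A M N n (p+1) :=
  ((shiftB k A p).toLinearMap).comp <|
    (rmulBase k A p).comp <|
      ((TensorProduct.comm k A
          (pwr k A (ModuleCat.of k (N ⊗[k] A)) p : Type)).toLinearMap).comp <|
        (TensorProduct.map (LinearMap.id : A →ₗ[k] A) ((rhoBase k A ρN p).comp f)).comp <|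
          ((TensorProduct.assoc k A (Pk k A n : Type) M).toLinearMap).comp
            (TensorProduct.map (dL k A n) (LinearMap.id : M →ₗ[k] M))

/-- `c_{p+1}`: uses the right comodule structure of `M`. -/
def cofLast (n p : ℕ) (f : Yc k A M N n p) : Yc k A M N n (p+1) :=
  (TensorProduct.map f (μA k A)).comp <|
    ((TensorProduct.tensorTensorTensorComm k (Pk k A n : Type) A M A).toLinearMap).comp
      (TensorProduct.map (dR k A n) ρM)

/-- The Yetter-Drinfel'd vertical cofaces `c_j^{n,p}`, `0 ≤ j ≤ p+1`. -/
def cYD (n p : ℕ) (j : ℕ) (f : Yc k A M N n p) : Yc k A M N n (p+1) :=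
  if j = 0 then cof0YD k A ρN n p f
  else if j ≤ p then (comulAt k A p j).comp f
  else cofLast k A ρM n p f

/-- The Hopf-module vertical cofaces `c_j^{n,p}`, `0 ≤ j ≤ p+1`. -/
def cH (n p : ℕ) (j : ℕ) (f : Yc k A M N n p) : Yc k A M N n (p+1) :=
  if j = 0 then cof0H k A ρN n p f
  else if j ≤ p then (comulAt k A p j).comp f
  else cofLast k A ρM n p f

/-- The horizontal differential (Yetter-Drinfel'd case). -/
def dmYD (n p : ℕ) (f : Yc k A M N n p) : Yc k A M N (n+1) p :=
  ∑ i ∈ Finset.range (n+2), ((-1 : ℤ)^i) • bYD k A ωM ωN n p i f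

/-- The vertical differential (Yetter-Drinfel'd case). -/
def dcYD (n p : ℕ) (f : Yc k A M N n p) : Yc k A M N n (p+1) :=
  ∑ j ∈ Finset.range (p+2), ((-1 : ℤ)^j) • cYD k A ρM ρN n p j f

/-- The horizontal differential (Hopf-module case). -/
def dmH (n p : ℕ) (f : Yc k A M N n p) : Yc k A M N (n+1) p :=
  ∑ i ∈ Finset.range (n+2), ((-1 : ℤ)^i) • bH k A ωM ωN n p i f

/-- The vertical differential (Hopf-module case). -/
def dcH (n p : ℕ) (f : Yc k A M N n p) : Yc k A M N n (p+1) :=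
  ∑ j ∈ Finset.range (p+2), ((-1 : ℤ)^j) • cH k A ρM ρN n p j f

end Bicomplex

section Structures

variable {M : Type} [AddCommGroup M] [Module k M]

/-- `(M, ωM)` is a left `A`-module. -/
def IsModule (ωM : A ⊗[k] M →ₗ[k] M) : Prop :=
  (∀ m : M, ωM ((1 : A) ⊗ₜ m) = m) ∧
  ∀ (a b : A) (m : M), ωM (a ⊗ₜ ωM (b ⊗ₜ m)) = ωM ((a * b) ⊗ₜ m)

/-- `(M, ρM)` is a right `A`-comodule. -/
def IsComodule (ρM : M →ₗ[k] M ⊗[k] A) : Prop :=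
  ((TensorProduct.rid k M).toLinearMap.comp
      ((TensorProduct.map (LinearMap.id : M →ₗ[k] M) (εA k A)).comp ρM) = LinearMap.id) ∧
  (TensorProduct.map ρM (LinearMap.id : A →ₗ[k] A)).comp ρM =
    ((TensorProduct.assoc k M A A).symm.toLinearMap).comp
      ((TensorProduct.map (LinearMap.id : M →ₗ[k] M) (ΔA k A)).comp ρM)

/-- The map `a ⊗ m ↦ Σ a_1·m_0 ⊗ a_2 m_1`. -/
def hopfRHS (ωM : A ⊗[k] M →ₗ[k] M) (ρM : M →ₗ[k] M ⊗[k] A) :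
    A ⊗[k] M →ₗ[k] M ⊗[k] A :=
  (TensorProduct.map ωM (μA k A)).comp <|
    ((TensorProduct.tensorTensorTensorComm k A A M A).toLinearMap).comp
      (TensorProduct.map (ΔA k A) ρM)

/-- The map `a ⊗ m ↦ Σ (a_2·m)_0 ⊗ (a_2·m)_1 a_1`. -/
def ydLHS (ωM : A ⊗[k] M →ₗ[k] M) (ρM : M →ₗ[k] M ⊗[k] A) :
    A ⊗[k] M →ₗ[k] M ⊗[k] A :=
  (TensorProduct.map (LinearMap.id : M →ₗ[k] M) (μA k A)).comp <|
    ((TensorProduct.assoc k M A A).toLinearMap).comp <|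
      ((TensorProduct.comm k A (M ⊗[k] A)).toLinearMap).comp <|
        (TensorProduct.map (LinearMap.id : A →ₗ[k] A) (ρM.comp ωM)).comp <|
          ((TensorProduct.assoc k A A M).toLinearMap).comp
            (TensorProduct.map (ΔA k A) (LinearMap.id : M →ₗ[k] M))

/-- `(M, ωM, ρM)` is a left-right Yetter-Drinfel'd module over `A`. -/
def IsYetterDrinfeld (ωM : A ⊗[k] M →ₗ[k] M) (ρM : M →ₗ[k] M ⊗[k] A) : Prop :=
  IsModule k A ωM ∧ IsComodule k A ρM ∧
    ydLHS k A ωM ρM = hopfRHS k A ωM ρM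

/-- `(M, ωM, ρM)` is a left-right Hopf module over `A`. -/
def IsHopfModule (ωM : A ⊗[k] M →ₗ[k] M) (ρM : M →ₗ[k] M ⊗[k] A) : Prop :=
  IsModule k A ωM ∧ IsComodule k A ρM ∧
    ρM.comp ωM = hopfRHS k A ωM ρM

end Structures


section Free

variable (k : Type) [Field k] (A : Type) [Ring A] [Bialgebra k A]
variable (V : Type) [AddCommGroup V] [Module k V]

/-- The free Hopf-module action on `V ⊗ A`: `a · (v ⊗ b) = v ⊗ ab`. -/
def ωFree : A ⊗[k] (V ⊗[k] A) →ₗ[k] V ⊗[k] A :=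
  (TensorProduct.map (LinearMap.id : V →ₗ[k] V) (μA k A)).comp
    (TensorProduct.leftComm k A V A).toLinearMap

/-- The free Hopf-module coaction on `V ⊗ A`: `ρ(v ⊗ a) = Σ v ⊗ a_1 ⊗ a_2`. -/
def ρFree : V ⊗[k] A →ₗ[k] (V ⊗[k] A) ⊗[k] A :=
  ((TensorProduct.assoc k V A A).symm.toLinearMap).comp
    (TensorProduct.map (LinearMap.id : V →ₗ[k] V) (ΔA k A))

end Free

section Auxiliary

variable {k A}
variable {X Y Z : Type} [AddCommMonoid X] [Module k X] [AddCommMonoid Y] [Module k Y]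
  [AddCommMonoid Z] [Module k Z]

/-- The diagonal action of `A` on `X ⊗ A`. -/
def diagAct (ω : A ⊗[k] X →ₗ[k] X) : A ⊗[k] (X ⊗[k] A) →ₗ[k] X ⊗[k] A :=
  (TensorProduct.map ω (μA k A)).comp <|
    ((TensorProduct.tensorTensorTensorComm k A A X A).toLinearMap).comp
      (TensorProduct.map (ΔA k A) LinearMap.id)

/-- Compatibility of a linear map with two actions of `A`. -/
def ActLinear (ω : A ⊗[k] X →ₗ[k] X) (ω' : A ⊗[k] Y →ₗ[k] Y) (f : X →ₗ[k] Y) : Prop :=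
  ∀ a x, f (ω (a ⊗ₜ x)) = ω' (a ⊗ₜ f x)

variable (k A X) in
/-- The cofree coaction on `X ⊗ A`. -/
def cofreeCoact : X ⊗[k] A →ₗ[k] (X ⊗[k] A) ⊗[k] A :=
  ((TensorProduct.assoc k X A A).symm.toLinearMap).comp
    (TensorProduct.map LinearMap.id (ΔA k A))

variable (A) in
/-- The map `f ⊗ id_A`. -/
abbrev tensId (f : X →ₗ[k] Y) : X ⊗[k] A →ₗ[k] Y ⊗[k] A :=
  TensorProduct.map f LinearMap.id

lemma ActLinear.comp {ω : A ⊗[k] X →ₗ[k] X} {ω' : A ⊗[k] Y →ₗ[k] Y} {ω'' : A ⊗[k] Z →ₗ[k] Z}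
    {f : X →ₗ[k] Y} {h : Y →ₗ[k] Z} (hh : ActLinear ω' ω'' h) (hf : ActLinear ω ω' f) :
    ActLinear ω ω'' (h.comp f) := fun a x => by
  simp only [LinearMap.comp_apply, hf a x, hh a (f x)]

lemma ActLinear.add {ω : A ⊗[k] X →ₗ[k] X} {ω' : A ⊗[k] Y →ₗ[k] Y}
    {f h : X →ₗ[k] Y} (hf : ActLinear ω ω' f) (hh : ActLinear ω ω' h) :
    ActLinear ω ω' (f + h) := fun a x => by
  simp only [LinearMap.add_apply, hf a x, hh a x, TensorProduct.tmul_add, map_add]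

lemma ActLinear.smul {ω : A ⊗[k] X →ₗ[k] X} {ω' : A ⊗[k] Y →ₗ[k] Y}
    {f : X →ₗ[k] Y} (hf : ActLinear ω ω' f) (z : k) : ActLinear ω ω' (z • f) := fun a x => by
  simp only [LinearMap.smul_apply, hf a x,
    TensorProduct.tmul_smul, map_smul]

lemma diagAct_tmul (ω : A ⊗[k] X →ₗ[k] X) (a : A) (x : X) (b : A) :
    diagAct ω (a ⊗ₜ (x ⊗ₜ b)) =
      TensorProduct.map (ω.comp ((TensorProduct.mk k A X).flip x)) (LinearMap.mulRight k b)
        (ΔA k A a) := by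
  simp only [diagAct, LinearMap.comp_apply, TensorProduct.map_tmul, LinearMap.id_apply]
  generalize ΔA k A a = t
  induction t with
  | zero => simp
  | add s t hs ht => simp only [TensorProduct.add_tmul, map_add, hs, ht]
  | tmul c d => simp

lemma ActLinear.tensId {ω : A ⊗[k] X →ₗ[k] X} {ω' : A ⊗[k] Y →ₗ[k] Y} {f : X →ₗ[k] Y}
    (hf : ActLinear ω ω' f) : ActLinear (diagAct ω) (diagAct ω') (tensId A f) := fun a t => by
  induction t with
  | zero => simp
  | add s t hs ht => simp only [TensorProduct.tmul_add, map_add, hs, ht]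
  | tmul x b =>
    simp only [TensorProduct.map_tmul, LinearMap.id_apply, diagAct_tmul]
    generalize ΔA k A a = t
    induction t with
    | zero => simp
    | add s t hs ht => simp only [map_add, hs, ht]
    | tmul c d => simp [hf c x]

lemma cofreeCoact_tmul (x : X) (b : A) :
    cofreeCoact k A X (x ⊗ₜ b) =
      TensorProduct.map (TensorProduct.mk k X A x) LinearMap.id (ΔA k A b) := by
  simp only [cofreeCoact, LinearMap.comp_apply, TensorProduct.map_tmul, LinearMap.id_apply]
  generalize ΔA k A b = t
  induction t with
  | zero => simp
  | add s t hs ht => simp only [TensorProduct.tmul_add, map_add, hs, ht]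
  | tmul c d => simp

lemma cofreeCoact_actLinear (ω : A ⊗[k] X →ₗ[k] X) :
    ActLinear (diagAct ω) (diagAct (diagAct ω)) (cofreeCoact k A X) := fun a t => by
  induction t with
  | zero => simp
  | add s t hs ht => simp only [TensorProduct.tmul_add, map_add, hs, ht]
  | tmul x b =>
    rw [diagAct_tmul, cofreeCoact_tmul]
    set wx := ω.comp ((TensorProduct.mk k A X).flip x) with hwx
    have key : ∀ t : A ⊗[k] A,
        (TensorProduct.assoc k X A A).symm (TensorProduct.map wx
            ((LinearMap.mulRight k t).comp (ΔA k A)) (ΔA k A a)) =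
          diagAct (diagAct ω) (a ⊗ₜ TensorProduct.map (TensorProduct.mk k X A x)
            LinearMap.id t) := by
      intro t
      induction t with
      | zero => simp [LinearMap.mulRight_zero_eq_zero]
      | add s t hs ht =>
        rw [map_add, TensorProduct.tmul_add, map_add, ← hs, ← ht, ← map_add, ← LinearMap.add_apply,
          ← TensorProduct.map_add_right, ← LinearMap.add_comp]
        congr 5
        ext
        simp [mul_add]
      | tmul c d =>
        rw [TensorProduct.map_tmul, LinearMap.id_apply, TensorProduct.mk_apply, diagAct_tmul]
        have h1 : ∀ s : A ⊗[k] A, (TensorProduct.assoc k X A A).symm (TensorProduct.map wx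
            ((LinearMap.mulRight k (c ⊗ₜ[k] d)).comp (ΔA k A)) s) =
            TensorProduct.map (TensorProduct.map wx (LinearMap.mulRight k c))
              (LinearMap.mulRight k d) ((TensorProduct.assoc k A A A).symm
                (TensorProduct.map LinearMap.id (ΔA k A) s)) := by
          intro s
          induction s with
          | zero => simp
          | add s t hs ht => simp only [map_add, hs, ht]
          | tmul u v =>
            simp only [TensorProduct.map_tmul, LinearMap.id_apply, LinearMap.comp_apply]
            generalize ΔA k A v = r
            induction r with
            | zero => simp
            | add s t hs ht => simp only [map_add, TensorProduct.tmul_add, hs, ht]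
            | tmul y z => simp
        have h2 : ∀ s : A ⊗[k] A, TensorProduct.map ((diagAct ω).comp
              ((TensorProduct.mk k A (X ⊗[k] A)).flip (x ⊗ₜ c))) (LinearMap.mulRight k d) s =
            TensorProduct.map (TensorProduct.map wx (LinearMap.mulRight k c))
              (LinearMap.mulRight k d) (TensorProduct.map (ΔA k A) LinearMap.id s) := by
          intro s
          induction s with
          | zero => simp
          | add s t hs ht => simp only [map_add, hs, ht]
          | tmul u v => simp [diagAct_tmul, hwx]
        rw [h1, h2]
        congr 1
        exact (Coalgebra.coassoc_symm_apply a)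
    rw [← key, cofreeCoact, LinearMap.comp_apply, LinearEquiv.coe_coe]
    congr 1
    have h : ∀ s : A ⊗[k] A, TensorProduct.map LinearMap.id (ΔA k A)
        (TensorProduct.map wx (LinearMap.mulRight k b) s) =
        TensorProduct.map wx ((LinearMap.mulRight k (ΔA k A b)).comp (ΔA k A)) s := by
      intro s
      induction s with
      | zero => simp
      | add s t hs ht => simp only [map_add, hs, ht]
      | tmul u v => simp [Bialgebra.comul_mul]
    exact h _

lemma cofreeCoact_natural (f : X →ₗ[k] Y) :
    (tensId A (tensId A f)).comp (cofreeCoact k A X) = (cofreeCoact k A Y).comp (tensId A f) := by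
  ext x b
  simp only [TensorProduct.AlgebraTensorModule.curry_apply, TensorProduct.curry_apply,
    LinearMap.coe_restrictScalars, LinearMap.comp_apply, TensorProduct.map_tmul,
    LinearMap.id_apply, cofreeCoact_tmul]
  generalize ΔA k A b = t
  induction t with
  | zero => simp
  | add s t hs ht => simp only [map_add, hs, ht]
  | tmul c d => simp

lemma cofreeCoact_coassoc :
    (tensId A (cofreeCoact k A X)).comp (cofreeCoact k A X) =
      (cofreeCoact k A (X ⊗[k] A)).comp (cofreeCoact k A X) := by
  ext x b
  simp only [TensorProduct.AlgebraTensorModule.curry_apply, TensorProduct.curry_apply,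
    LinearMap.coe_restrictScalars, LinearMap.comp_apply, cofreeCoact_tmul]
  have h1 : ∀ s : A ⊗[k] A, tensId A (cofreeCoact k A X)
      (TensorProduct.map (TensorProduct.mk k X A x) LinearMap.id s) =
      tensId A (tensId A (TensorProduct.mk k X A x))
        (TensorProduct.map (ΔA k A) LinearMap.id s) := by
    intro s
    induction s with
    | zero => simp
    | add s t hs ht => simp only [map_add, hs, ht]
    | tmul u v => simp [cofreeCoact_tmul]
  have h2 := fun s =>
    LinearMap.congr_fun (cofreeCoact_natural (A := A) (TensorProduct.mk k X A x)) s
  simp only [LinearMap.comp_apply] at h2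
  rw [h1, ← h2]
  congr 1
  exact (Coalgebra.coassoc_symm_apply b).symm

variable (k A X) in
/-- Applying the counit to the `A`-factor of `X ⊗ A`. -/
def counitRight : X ⊗[k] A →ₗ[k] X :=
  (TensorProduct.rid k X).toLinearMap.comp (TensorProduct.map LinearMap.id (εA k A))

lemma counitRight_tmul (x : X) (a : A) : counitRight k A X (x ⊗ₜ a) = εA k A a • x := by
  simp [counitRight]

variable (k A X) in
/-- The trivial action of `A` on `X` through the counit. -/
def trivAct : A ⊗[k] X →ₗ[k] X :=
  (TensorProduct.lid k X).toLinearMap.comp (TensorProduct.map (εA k A) LinearMap.id)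

lemma trivAct_tmul (a : A) (x : X) : trivAct k A X (a ⊗ₜ x) = εA k A a • x := by
  simp [trivAct]

lemma counitRight_cofreeCoact :
    (tensId A (counitRight k A X)).comp (cofreeCoact k A X) = LinearMap.id := by
  ext x b
  simp only [TensorProduct.AlgebraTensorModule.curry_apply, TensorProduct.curry_apply,
    LinearMap.coe_restrictScalars, LinearMap.comp_apply, cofreeCoact_tmul, LinearMap.id_apply]
  have h : ∀ s : A ⊗[k] A, tensId A (counitRight k A X)
      (TensorProduct.map (TensorProduct.mk k X A x) LinearMap.id s) =
      x ⊗ₜ[k] (TensorProduct.lid k A (TensorProduct.map (εA k A) LinearMap.id s)) := by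
    intro s
    induction s with
    | zero => simp
    | add s t hs ht => simp only [map_add, hs, ht, TensorProduct.tmul_add]
    | tmul u v => simp [counitRight_tmul, TensorProduct.smul_tmul]
  rw [h]
  have h' := Coalgebra.rTensor_counit_comul (R := k) b
  rw [LinearMap.rTensor] at h'
  rw [h', TensorProduct.lid_tmul, one_smul]

lemma tensId_comp (h : Y →ₗ[k] Z) (f : X →ₗ[k] Y) :
    tensId A (h.comp f) = (tensId A h).comp (tensId A f) := by
  ext; rfl

lemma tensId_add (f h : X →ₗ[k] Y) : tensId A (f + h) = tensId A f + tensId A h :=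
  TensorProduct.map_add_left f h _

lemma tensId_smul (z : k) (f : X →ₗ[k] Y) : tensId A (z • f) = z • tensId A f :=
  TensorProduct.map_smul_left z f _

lemma tensId_zero : tensId A (0 : X →ₗ[k] Y) = 0 := TensorProduct.map_zero_left _

lemma tensId_id : tensId A (LinearMap.id : X →ₗ[k] X) = LinearMap.id := TensorProduct.map_id

/-- The recursion step `E ↦ E ⊗ id_A + z • (id ⊗ Δ)` building the vertical differential. -/
def cofaceStep (z : k) (E : X →ₗ[k] X ⊗[k] A) : X ⊗[k] A →ₗ[k] (X ⊗[k] A) ⊗[k] A :=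
  tensId A E + z • cofreeCoact k A X

/-- The map `f ↦ E ∘ f + z • (f ⊗ id_A) ∘ ρ`, the general form of the vertical differential. -/
def vertDiff (z : k) (E : X →ₗ[k] X ⊗[k] A) (ρ : Y →ₗ[k] Y ⊗[k] A) (f : Y →ₗ[k] X) :
    Y →ₗ[k] X ⊗[k] A :=
  E.comp f + z • (tensId A f).comp ρ

lemma cofaceStep_neg_one_comp {ρ : X →ₗ[k] X ⊗[k] A}
    (hρ : (tensId A ρ).comp ρ = (cofreeCoact k A X).comp ρ) :
    (cofaceStep (-1) ρ).comp ρ = 0 := by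
  rw [cofaceStep, LinearMap.add_comp, hρ, LinearMap.smul_comp]
  module

lemma cofaceStep_comp_cofaceStep {z : k} {E : X →ₗ[k] X ⊗[k] A}
    (hE : (cofaceStep z E).comp E = 0) :
    (cofaceStep (-z) (cofaceStep z E)).comp (cofaceStep z E) = 0 := by
  have h1 : (tensId A (cofaceStep z E)).comp (tensId A E) = 0 := by
    rw [← tensId_comp, hE, tensId_zero]
  have h2 : (cofaceStep (-z) (cofaceStep z E)).comp (cofaceStep z E) =
      (tensId A (cofaceStep z E)).comp (tensId A E) +
      (z • (tensId A (cofaceStep z E)).comp (cofreeCoact k A X) +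
      (-z) • (cofreeCoact k A (X ⊗[k] A)).comp (cofaceStep z E)) := by
    rw [← LinearMap.comp_smul, ← add_assoc, ← LinearMap.comp_add, ← LinearMap.smul_comp]
    rfl
  rw [h2, h1, cofaceStep, tensId_add, tensId_smul]
  simp only [LinearMap.comp_add, LinearMap.add_comp, LinearMap.smul_comp, LinearMap.comp_smul,
    cofreeCoact_natural, cofreeCoact_coassoc]
  module

lemma vertDiff_vertDiff {z : k} (hz : z * z = 1) {E : X →ₗ[k] X ⊗[k] A}
    {ρ : Y →ₗ[k] Y ⊗[k] A} (hE : (cofaceStep z E).comp E = 0)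
    (hρ : (tensId A ρ).comp ρ = (cofreeCoact k A Y).comp ρ) (f : Y →ₗ[k] X) :
    vertDiff (-z) (cofaceStep z E) ρ (vertDiff z E ρ f) = 0 := by
  have h1 : (cofaceStep z E).comp (vertDiff z E ρ f) =
      z • (tensId A (E.comp f)).comp ρ + (cofreeCoact k A X).comp ((tensId A f).comp ρ) := by
    rw [vertDiff, LinearMap.comp_add, ← LinearMap.comp_assoc, hE, LinearMap.comp_smul, cofaceStep,
      LinearMap.zero_comp, zero_add, LinearMap.add_comp, LinearMap.smul_comp, smul_add, smul_smul,
      hz, one_smul, tensId_comp, LinearMap.comp_assoc]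
  have h2 : (tensId A (vertDiff z E ρ f)).comp ρ =
      (tensId A (E.comp f)).comp ρ + z • (cofreeCoact k A X).comp ((tensId A f).comp ρ) := by
    rw [vertDiff, tensId_add, tensId_smul, LinearMap.add_comp, LinearMap.smul_comp,
      tensId_comp _ ρ, LinearMap.comp_assoc, hρ, ← LinearMap.comp_assoc, cofreeCoact_natural,
      LinearMap.comp_assoc]
  rw [vertDiff, h1, h2, smul_add, smul_smul, neg_mul, hz]
  module

lemma contraction_step {z : k} {E : X →ₗ[k] X ⊗[k] A} {H : X ⊗[k] A →ₗ[k] X}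
    (h : (tensId A H).comp (cofaceStep z E) + E.comp H = LinearMap.id) :
    (tensId A (tensId A H)).comp (cofaceStep (-z) (cofaceStep z E)) +
      (cofaceStep z E).comp (tensId A H) = LinearMap.id := by
  have h1 := congrArg (tensId A) h
  rw [tensId_add, tensId_comp, tensId_comp, tensId_id] at h1
  have h2 : (tensId A (tensId A H)).comp (cofaceStep (-z) (cofaceStep z E)) =
      (tensId A (tensId A H)).comp (tensId A (cofaceStep z E)) +
        (-z) • (cofreeCoact k A X).comp (tensId A H) := by
    rw [← cofreeCoact_natural, ← LinearMap.comp_smul, ← LinearMap.comp_add]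
    rfl
  have h3 : (cofaceStep z E).comp (tensId A H) =
      (tensId A E).comp (tensId A H) + z • (cofreeCoact k A X).comp (tensId A H) := rfl
  rw [← h1, h2, h3]
  module

lemma vertDiff_contraction {z : k} {E : X →ₗ[k] X ⊗[k] A}
    {H : X ⊗[k] A →ₗ[k] X} {ρ : Y →ₗ[k] Y ⊗[k] A}
    (h : (tensId A H).comp (cofaceStep z E) + E.comp H = LinearMap.id)
    {g : Y →ₗ[k] X ⊗[k] A} (hg : vertDiff (-z) (cofaceStep z E) ρ g = 0) :
    vertDiff z E ρ (H.comp g) = g := by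
  have h1 := congrArg (fun F => F.comp g) h
  have h2 := congrArg (fun F => (tensId A H).comp F) hg
  simp only [vertDiff, LinearMap.comp_add, LinearMap.comp_smul, LinearMap.comp_zero,
    LinearMap.add_comp, LinearMap.id_comp, LinearMap.comp_assoc] at h1 h2
  rw [vertDiff, tensId_comp, LinearMap.comp_assoc]
  calc _ = E.comp (H.comp g) + z • (tensId A H).comp ((tensId A g).comp ρ) +
          ((tensId A H).comp ((cofaceStep z E).comp g) +
            (-z) • (tensId A H).comp ((tensId A g).comp ρ)) := by rw [h2, add_zero]
    _ = (tensId A H).comp ((cofaceStep z E).comp g) + E.comp (H.comp g) := by module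
    _ = g := h1

lemma vertDiff_actLinear {ω : A ⊗[k] X →ₗ[k] X} {ω' : A ⊗[k] Y →ₗ[k] Y} {z : k}
    {E : X →ₗ[k] X ⊗[k] A} {ρ : Y →ₗ[k] Y ⊗[k] A} {f : Y →ₗ[k] X}
    (hE : ActLinear ω (diagAct ω) E) (hρ : ActLinear ω' (diagAct ω') ρ)
    (hf : ActLinear ω' ω f) : ActLinear ω' (diagAct ω) (vertDiff z E ρ f) :=
  (hE.comp hf).add ((hf.tensId.comp hρ).smul z)

lemma tensId_sum {ι : Type*} (s : Finset ι) (F : ι → X →ₗ[k] Y) :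
    tensId A (∑ i ∈ s, F i) = ∑ i ∈ s, tensId A (F i) :=
  map_sum (⟨⟨fun f : X →ₗ[k] Y => tensId A f, tensId_zero⟩, tensId_add⟩ :
    (X →ₗ[k] Y) →+ (X ⊗[k] A →ₗ[k] Y ⊗[k] A)) F s

lemma sum_add_eq_cofaceStep {ι : Type*} (s : Finset ι) (c : ι → k) (z : k)
    {F : ι → X →ₗ[k] X ⊗[k] A} {G : ι → X ⊗[k] A →ₗ[k] (X ⊗[k] A) ⊗[k] A}
    {L : X ⊗[k] A →ₗ[k] (X ⊗[k] A) ⊗[k] A} (hG : ∀ i ∈ s, G i = tensId A (F i))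
    (hL : L = cofreeCoact k A X) :
    ∑ i ∈ s, c i • G i + z • L = cofaceStep z (∑ i ∈ s, c i • F i) := by
  rw [cofaceStep, tensId_sum, hL]
  congr 1
  exact Finset.sum_congr rfl fun i hi => by rw [hG i hi, tensId_smul]

end Auxiliary

section Powers

variable {k A}
variable {X Y : Type} [AddCommGroup X] [Module k X] [AddCommGroup Y] [Module k Y]

lemma ωFree_tmul (a : A) (x : X) (b : A) : ωFree k A X (a ⊗ₜ (x ⊗ₜ b)) = x ⊗ₜ (a * b) := by
  simp [ωFree]

lemma diagAct_trivAct : diagAct (trivAct k A X) = ωFree k A X := by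
  ext a x b
  simp only [TensorProduct.AlgebraTensorModule.curry_apply, TensorProduct.curry_apply,
    LinearMap.coe_restrictScalars, diagAct_tmul, ωFree_tmul]
  have h : ∀ s : A ⊗[k] A, TensorProduct.map
      ((trivAct k A X).comp ((TensorProduct.mk k A X).flip x)) (LinearMap.mulRight k b) s =
      x ⊗ₜ[k] ((TensorProduct.lid k A (TensorProduct.map (εA k A) LinearMap.id s)) * b) := by
    intro s
    induction s with
    | zero => simp
    | add s t hs ht => simp only [map_add, hs, ht, add_mul, TensorProduct.tmul_add]
    | tmul u v => simp [trivAct_tmul, TensorProduct.smul_tmul]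
  rw [h]
  have h' := Coalgebra.rTensor_counit_comul (R := k) a
  rw [LinearMap.rTensor] at h'
  rw [h', TensorProduct.lid_tmul, one_smul]

lemma counitRight_actLinear : ActLinear (ωFree k A X) (trivAct k A X) (counitRight k A X) := by
  intro a t
  induction t with
  | zero => simp
  | add s t hs ht => simp only [TensorProduct.tmul_add, map_add, hs, ht]
  | tmul x b => simp [ωFree_tmul, counitRight_tmul, trivAct_tmul, mul_smul, smul_comm (εA k A b)]

/-- The alternating sum of all cofaces of `X ⊗ A^{⊗ p}` but the last one. -/
def innerCoface (ρ : X →ₗ[k] X ⊗[k] A) : (p : ℕ) → (Cd k A X p →ₗ[k] Cd k A X p ⊗[k] A)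
  | 0 => ρ
  | p + 1 => cofaceStep ((-1) ^ (p + 1)) (innerCoface ρ p)

variable (k A X) in
/-- The contraction of `(X ⊗ A) ⊗ A^{⊗ (p+1)}` by the counit on the first `A`-factor. -/
def contraction : (p : ℕ) → (Cd k A (X ⊗[k] A) p ⊗[k] A →ₗ[k] Cd k A (X ⊗[k] A) p)
  | 0 => tensId A (counitRight k A X)
  | p + 1 => tensId A (contraction p)

lemma neg_one_pow_mul_self (n : ℕ) : (-1 : k) ^ n * (-1) ^ n = 1 := by
  rw [← mul_pow, neg_one_mul, neg_neg, one_pow]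

lemma contraction_actLinear (p : ℕ) :
    ActLinear (diagAct (ldiag k A (ωFree k A X) p)) (ldiag k A (ωFree k A X) p)
      (contraction k A X p) := by
  induction p with
  | zero =>
    have h := (counitRight_actLinear (k := k) (A := A) (X := X)).tensId
    rw [diagAct_trivAct] at h
    exact h
  | succ p ih => exact ih.tensId

lemma innerCoface_actLinear {ω : A ⊗[k] X →ₗ[k] X} {ρ : X →ₗ[k] X ⊗[k] A}
    (h : ActLinear ω (diagAct ω) ρ) (p : ℕ) :
    ActLinear (ldiag k A ω p) (diagAct (ldiag k A ω p)) (innerCoface ρ p) := by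
  induction p with
  | zero => exact h
  | succ p ih => exact ih.tensId.add ((cofreeCoact_actLinear _).smul _)

lemma innerCoface_comp {ρ : X →ₗ[k] X ⊗[k] A}
    (hρ : (tensId A ρ).comp ρ = (cofreeCoact k A X).comp ρ) (p : ℕ) :
    (cofaceStep ((-1) ^ (p + 1)) (innerCoface ρ p)).comp (innerCoface ρ p) = 0 := by
  induction p with
  | zero =>
    rw [zero_add, pow_one]
    exact cofaceStep_neg_one_comp hρ
  | succ p ih =>
    rw [pow_succ _ (p + 1), mul_neg_one]
    exact cofaceStep_comp_cofaceStep ih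

lemma contraction_homotopy (p : ℕ) :
    (tensId A (contraction k A X p)).comp
        (cofaceStep ((-1) ^ (p + 1)) (innerCoface (ρFree k A X) p)) +
      (innerCoface (ρFree k A X) p).comp (contraction k A X p) = LinearMap.id := by
  induction p with
  | zero =>
    change (tensId A (tensId A (counitRight k A X))).comp
        (cofaceStep ((-1) ^ (0 + 1)) (cofreeCoact k A X)) +
      (cofreeCoact k A X).comp (tensId A (counitRight k A X)) = LinearMap.id
    rw [cofaceStep, LinearMap.comp_add, LinearMap.comp_smul, cofreeCoact_natural, ← tensId_comp,
      counitRight_cofreeCoact, tensId_id]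
    module
  | succ p ih =>
    rw [pow_succ _ (p + 1), mul_neg_one]
    exact contraction_step ih

/-- The coface of index `j` on `X ⊗ A^{⊗ p}`, for `j ≤ p`. -/
def innerCofaceAt (ρ : X →ₗ[k] X ⊗[k] A) (p j : ℕ) : Cd k A X p →ₗ[k] Cd k A X (p + 1) :=
  if j = 0 then (shiftB k A p).toLinearMap.comp (rhoBase k A ρ p) else comulAt k A p j

lemma innerCofaceAt_zero (ρ : X →ₗ[k] X ⊗[k] A) (p : ℕ) :
    innerCofaceAt ρ p 0 = (shiftB k A p).toLinearMap.comp (rhoBase k A ρ p) := if_pos rfl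

lemma innerCofaceAt_of_ne_zero (ρ : X →ₗ[k] X ⊗[k] A) (p : ℕ) {j : ℕ} (hj : j ≠ 0) :
    innerCofaceAt ρ p j = comulAt k A p j := if_neg hj

lemma innerCofaceAt_succ (ρ : X →ₗ[k] X ⊗[k] A) {p j : ℕ} (hj : j ≤ p) :
    innerCofaceAt ρ (p + 1) j = tensId A (innerCofaceAt ρ p j) := by
  rcases eq_or_ne j 0 with rfl | h
  · rw [innerCofaceAt_zero, innerCofaceAt_zero]
    exact (tensId_comp _ _).symm
  · rw [innerCofaceAt_of_ne_zero _ _ h, innerCofaceAt_of_ne_zero _ _ h]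
    exact if_neg (by omega)

lemma innerCofaceAt_last (ρ : X →ₗ[k] X ⊗[k] A) (p : ℕ) :
    innerCofaceAt ρ (p + 1) (p + 1) = cofreeCoact k A (Cd k A X p) :=
  (innerCofaceAt_of_ne_zero _ _ (Nat.succ_ne_zero p)).trans (if_pos rfl)

lemma sum_innerCofaceAt (ρ : X →ₗ[k] X ⊗[k] A) (p : ℕ) :
    ∑ j ∈ Finset.range (p + 1), (-1 : k) ^ j • innerCofaceAt ρ p j = innerCoface ρ p := by
  induction p with
  | zero =>
    refine (Finset.sum_range_one _).trans ?_
    rw [pow_zero, one_smul, innerCofaceAt_zero]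
    rfl
  | succ p ih =>
    rw [innerCoface, ← ih]
    exact (Finset.sum_range_succ _ _).trans (sum_add_eq_cofaceStep _ _ _
      (fun j hj => innerCofaceAt_succ ρ (Nat.lt_succ_iff.mp (Finset.mem_range.mp hj)))
      (innerCofaceAt_last ρ p))

/-- The action of `A` on `A^{⊗ 0} ⊗ Y = k ⊗ Y` induced by an action on `Y`. -/
def domAct (ω : A ⊗[k] Y →ₗ[k] Y) : A ⊗[k] Dm k A Y 0 →ₗ[k] Dm k A Y 0 :=
  (TensorProduct.map LinearMap.id ω).comp
    (TensorProduct.leftComm k A (Pk k A 0) Y).toLinearMap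

/-- The coaction of `A` on `A^{⊗ 0} ⊗ Y = k ⊗ Y` induced by a coaction on `Y`. -/
def domCoact (ρ : Y →ₗ[k] Y ⊗[k] A) : Dm k A Y 0 →ₗ[k] Dm k A Y 0 ⊗[k] A :=
  (TensorProduct.assoc k (Pk k A 0) Y A).symm.toLinearMap.comp
    (TensorProduct.map LinearMap.id ρ)

lemma dmH_zero_apply (ωM : A ⊗[k] Y →ₗ[k] Y) (ωN : A ⊗[k] X →ₗ[k] X) (p : ℕ)
    (f : Yc k A Y X 0 p) (a : A) (c : Pk k A 0) (y : Y) :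
    dmH k A ωM ωN 0 p f (((c ⊗ₜ[k] a : (Pk k A 0 : Type) ⊗[k] A) : Pk k A 1) ⊗ₜ[k] y) =
      ldiag k A ωN p (a ⊗ₜ f (c ⊗ₜ y)) - f (domAct ωM (a ⊗ₜ (c ⊗ₜ y))) := by
  have h : dmH k A ωM ωN 0 p f = face0 k A ωN 0 p f - faceLastH k A ωM 0 p f := by
    simp [dmH, Finset.sum_range_succ, bH, sub_eq_add_neg]
  rw [h]
  rfl

lemma dmH_zero_eq_zero_iff (ωM : A ⊗[k] Y →ₗ[k] Y) (ωN : A ⊗[k] X →ₗ[k] X) (p : ℕ)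
    (f : Yc k A Y X 0 p) :
    dmH k A ωM ωN 0 p f = 0 ↔ ActLinear (domAct ωM) (ldiag k A ωN p) f := by
  constructor
  · intro h a t
    induction t using TensorProduct.induction_on with
    | zero => simp
    | add s t hs ht => simp only [TensorProduct.tmul_add, map_add, hs, ht]
    | tmul c y =>
      have h' := dmH_zero_apply ωM ωN p f a c y
      rw [h, LinearMap.zero_apply] at h'
      exact (sub_eq_zero.mp h'.symm).symm
  · intro h
    refine TensorProduct.ext' fun t y => ?_
    refine TensorProduct.induction_on (R := k) (M := Pk k A 0) (N := A) t ?_ ?_ ?_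
    · exact (congrArg _ (TensorProduct.zero_tmul _ y)).trans (map_zero _)
    · intro c a
      exact (dmH_zero_apply ωM ωN p f a c y).trans (sub_eq_zero.mpr (h a (c ⊗ₜ y)).symm)
    · intro s t hs ht
      refine (congrArg _ (TensorProduct.add_tmul s t y)).trans ?_
      refine (map_add _ _ _).trans ?_
      exact (congrArg₂ (· + ·) hs ht).trans (add_zero _)

lemma cofLast_zero (ρM : Y →ₗ[k] Y ⊗[k] A) (p : ℕ) (f : Yc k A Y X 0 p) :
    cofLast k A ρM 0 p f = (tensId A f).comp (domCoact ρM) := by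
  refine TensorProduct.ext' fun c y => ?_
  change TensorProduct.map f (μA k A) (TensorProduct.tensorTensorTensorComm k (Pk k A 0) A Y A
    ((c ⊗ₜ[k] algebraMap k A 1) ⊗ₜ ρM y)) =
    tensId A f ((TensorProduct.assoc k (Pk k A 0) Y A).symm (c ⊗ₜ ρM y))
  generalize ρM y = t
  induction t with
  | zero => simp
  | add s t hs ht => simp only [TensorProduct.tmul_add, map_add, hs, ht]
  | tmul c d => simp

lemma dcH_zero (ρM : Y →ₗ[k] Y ⊗[k] A) (ρN : X →ₗ[k] X ⊗[k] A) (p : ℕ)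
    (f : Yc k A Y X 0 p) :
    dcH k A ρM ρN 0 p f =
      vertDiff ((-1) ^ (p + 1)) (innerCoface ρN p) (domCoact ρM) f := by
  have hc : ∀ (j : ℕ) (F : Yc k A Y X 0 (p + 1)), (-1 : ℤ) ^ j • F = (-1 : k) ^ j • F := by
    intro j F
    rw [← Int.cast_smul_eq_zsmul k]
    push_cast
    rfl
  have hj : ∀ j ∈ Finset.range (p + 1), (-1 : ℤ) ^ j • cH k A ρM ρN 0 p j f =
      ((-1 : k) ^ j • innerCofaceAt ρN p j).comp f := by
    intro j hj
    rw [hc, LinearMap.smul_comp]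
    congr 1
    unfold cH
    split_ifs with h h'
    · rw [h, innerCofaceAt_zero]; rfl
    · rw [innerCofaceAt_of_ne_zero _ _ h]
    · exact absurd (Nat.lt_succ_iff.mp (Finset.mem_range.mp hj)) h'
  have hs : ∑ j ∈ Finset.range (p + 1), ((-1 : k) ^ j • innerCofaceAt ρN p j).comp f =
      (∑ j ∈ Finset.range (p + 1), (-1 : k) ^ j • innerCofaceAt ρN p j).comp f := by
    refine LinearMap.ext fun x => ?_
    simp only [LinearMap.sum_apply, LinearMap.comp_apply]
  rw [dcH, Finset.sum_range_succ, Finset.sum_congr rfl hj, hs, sum_innerCofaceAt, hc, cH,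
    if_neg (by omega), if_neg (by omega), cofLast_zero]
  rfl

lemma domCoact_actLinear {ω : A ⊗[k] Y →ₗ[k] Y} {ρ : Y →ₗ[k] Y ⊗[k] A}
    (h : ActLinear ω (diagAct ω) ρ) :
    ActLinear (domAct ω) (diagAct (domAct ω)) (domCoact ρ) := by
  intro a t
  induction t using TensorProduct.induction_on with
  | zero => simp
  | add s t hs ht => simp only [TensorProduct.tmul_add, map_add, hs, ht]
  | tmul c y =>
    change (TensorProduct.assoc k (Pk k A 0) Y A).symm (c ⊗ₜ ρ (ω (a ⊗ₜ y))) =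
      diagAct (domAct ω) (a ⊗ₜ (TensorProduct.assoc k (Pk k A 0) Y A).symm (c ⊗ₜ ρ y))
    rw [h]
    generalize ρ y = r
    induction r with
    | zero => simp
    | add s t hs ht => simp only [TensorProduct.tmul_add, map_add, hs, ht]
    | tmul y b =>
      rw [TensorProduct.assoc_symm_tmul, diagAct_tmul, diagAct_tmul]
      generalize ΔA k A a = r
      induction r with
      | zero => simp
      | add s t hs ht => simp only [TensorProduct.tmul_add, map_add, hs, ht]
      | tmul u v => simp [domAct]

lemma domCoact_coassoc {ρ : Y →ₗ[k] Y ⊗[k] A}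
    (h : (tensId A ρ).comp ρ = (cofreeCoact k A Y).comp ρ) :
    (tensId A (domCoact ρ)).comp (domCoact ρ) =
      (cofreeCoact k A (Dm k A Y 0)).comp (domCoact ρ) := by
  refine TensorProduct.ext' fun c y => ?_
  have key : ∀ t : Y, domCoact ρ (c ⊗ₜ t) =
      tensId A (TensorProduct.mk k (Pk k A 0) Y c) (ρ t) := by
    intro t
    change (TensorProduct.assoc k (Pk k A 0) Y A).symm (c ⊗ₜ ρ t) = _
    generalize ρ t = r
    induction r with
    | zero => simp
    | add s t hs ht => simp only [TensorProduct.tmul_add, map_add, hs, ht]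
    | tmul u v => simp
  have hcomp : (domCoact ρ).comp (TensorProduct.mk k (Pk k A 0) Y c) =
      (tensId A (TensorProduct.mk k (Pk k A 0) Y c)).comp ρ := LinearMap.ext key
  rw [LinearMap.comp_apply, LinearMap.comp_apply, key, ← LinearMap.comp_apply (tensId A _),
    ← tensId_comp, hcomp, tensId_comp, LinearMap.comp_apply, ← LinearMap.comp_apply (tensId A ρ),
    h, ← LinearMap.comp_apply (cofreeCoact k A _), ← cofreeCoact_natural]
  rfl

lemma ρFree_actLinear : ActLinear (ωFree k A X) (diagAct (ωFree k A X)) (ρFree k A X) := by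
  rw [← diagAct_trivAct]
  exact cofreeCoact_actLinear _

end Powers



/-- `H^{p+1}(V ⊗ A, W ⊗ A) = 0` for all `p ≥ 0`: equivalently,
`Ker(d_m^{0,p+1}) ∩ Ker(d_c^{0,p+1}) = d_c^{0,p}(Ker(d_m^{0,p}))`. -/
theorem H_free_vanishes (k : Type) [Field k] (A : Type) [Ring A] [Bialgebra k A]
    (V W : Type) [AddCommGroup V] [Module k V] [AddCommGroup W] [Module k W]
    (p : ℕ) (g : Yc k A (V ⊗[k] A) (W ⊗[k] A) 0 (p+1)) :
    (dmH k A (ωFree k A V) (ωFree k A W) 0 (p+1) g = 0 ∧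
      dcH k A (ρFree k A V) (ρFree k A W) 0 (p+1) g = 0) ↔
    ∃ f : Yc k A (V ⊗[k] A) (W ⊗[k] A) 0 p,
      dmH k A (ωFree k A V) (ωFree k A W) 0 p f = 0 ∧
      dcH k A (ρFree k A V) (ρFree k A W) 0 p f = g := by
  have hV := domCoact_actLinear (ρFree_actLinear (k := k) (A := A) (X := V))
  have hcV := domCoact_coassoc (cofreeCoact_coassoc (k := k) (A := A) (X := V))
  have hsign : (-1 : k) ^ (p + 1 + 1) = -(-1) ^ (p + 1) := by rw [pow_succ _ (p + 1), mul_neg_one]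
  constructor
  · rintro ⟨hm, hc⟩
    rw [dmH_zero_eq_zero_iff] at hm
    rw [dcH_zero, hsign] at hc
    refine ⟨(contraction k A W p).comp g, ?_, ?_⟩
    · rw [dmH_zero_eq_zero_iff]
      exact (contraction_actLinear p).comp hm
    · rw [dcH_zero]
      exact vertDiff_contraction (contraction_homotopy p) hc
  · rintro ⟨f, hm, rfl⟩
    rw [dmH_zero_eq_zero_iff] at hm
    constructor
    · rw [dmH_zero_eq_zero_iff, dcH_zero]
      exact vertDiff_actLinear (innerCoface_actLinear ρFree_actLinear p) hV hm
    · rw [dcH_zero, dcH_zero, hsign]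
      exact vertDiff_vertDiff (neg_one_pow_mul_self _)
        (innerCoface_comp cofreeCoact_coassoc p) hcV f

end PS
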